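/- arXiv:1307.0441 — 4 statements merged into one kernel-verified Lean document; each statement's English description precedes it below -/
import Mathlib

section
/- For every union-disjoint factorised representation E over a finite schema S, the recursively defined count function — count(⟨A:a⟩) = 1 for every singleton, count(⟨⟩) = 1, count(∅) = 0, count(E₁ ∪ ⋯ ∪ Eₙ) = ∑ᵢ count(Eᵢ), and count(E₁ × ⋯ × Eₙ) = ∏ᵢ count(Eᵢ) — computes the cardinality of the represented relation: count(E) = |⟦E⟧|. -/
open scoped Classical

noncomputable section

/-- Attributes: a countable set, modelled as the natural numbers. -/
abbrev Attr := ℕ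

/-- A tuple over a finite schema `S` is modelled as a total function `Attr → ℝ`
that vanishes outside `S`. -/
abbrev Tuple := Attr → ℝ

/-- `t` is a tuple over the schema `S`: it vanishes outside `S`. -/
def IsOverSchema (t : Tuple) (S : Finset Attr) : Prop := ∀ A ∉ S, t A = 0

/-- Factorised representations over a finite schema: singletons `⟨A:a⟩`,
the nullary tuple `⟨⟩`, the empty expression `∅` (over any schema),
unions of factorisations over the same schema, and products of factorisations
over disjoint schemas. -/
inductive FRep : Finset Attr → Type
  | sing (A : Attr) (a : ℝ) : FRep {A}
  | unit : FRep ∅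
  | empty (S : Finset Attr) : FRep S
  | union {S : Finset Attr} (E₁ E₂ : FRep S) : FRep S
  | prod {S₁ S₂ : Finset Attr} (h : Disjoint S₁ S₂) (E₁ : FRep S₁) (E₂ : FRep S₂) :
      FRep (S₁ ∪ S₂)

namespace FRep

/-- The represented relation `⟦E⟧`.  A tuple over `S₁ ∪ S₂` extending a tuple over
`S₁` and a tuple over `S₂` (for disjoint `S₁`, `S₂`) is their pointwise sum, since
tuples vanish outside their schemas. -/
def rel : {S : Finset Attr} → FRep S → Finset Tuple
  | _, sing A a => {fun B => if B = A then a else 0}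
  | _, unit => {fun _ => 0}
  | _, empty _ => ∅
  | _, union E₁ E₂ => rel E₁ ∪ rel E₂
  | _, prod _ E₁ E₂ => (rel E₁ ×ˢ rel E₂).image fun p => p.1 + p.2

/-- `E` is union-disjoint: in every union subexpression of `E`, the represented
relations of the components are pairwise disjoint. -/
def UnionDisjoint : {S : Finset Attr} → FRep S → Prop
  | _, sing _ _ => True
  | _, unit => True
  | _, empty _ => True
  | _, union E₁ E₂ => Disjoint (rel E₁) (rel E₂) ∧ UnionDisjoint E₁ ∧ UnionDisjoint E₂
  | _, prod _ E₁ E₂ => UnionDisjoint E₁ ∧ UnionDisjoint E₂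

/-- The recursively defined count function:
`count ⟨A:a⟩ = 1`, `count ⟨⟩ = 1`, `count ∅ = 0`, counts of unions are sums,
counts of products are products. -/
def count : {S : Finset Attr} → FRep S → ℕ
  | _, sing _ _ => 1
  | _, unit => 1
  | _, empty _ => 0
  | _, union E₁ E₂ => count E₁ + count E₂
  | _, prod _ E₁ E₂ => count E₁ * count E₂

end FRep

theorem FRep.rel_over {S : Finset Attr} (E : FRep S) :
    ∀ t ∈ E.rel, IsOverSchema t S := by
  induction E with
  | sing A a =>
    intro t ht B hB
    simp only [FRep.rel, Finset.mem_singleton] at ht hB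
    subst ht
    simp [hB]
  | unit =>
    intro t ht B hB
    simp only [FRep.rel, Finset.mem_singleton] at ht
    subst ht
    rfl
  | empty S =>
    intro t ht
    simp [FRep.rel] at ht
  | union E₁ E₂ h₁ h₂ =>
    intro t ht
    simp only [FRep.rel, Finset.mem_union] at ht
    exact ht.elim (h₁ t) (h₂ t)
  | prod h E₁ E₂ h₁ h₂ =>
    intro t ht B hB
    simp only [FRep.rel, Finset.mem_image, Finset.mem_product] at ht
    obtain ⟨p, ⟨hp1, hp2⟩, rfl⟩ := ht
    simp only [Finset.mem_union, not_or] at hB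
    simp [h₁ _ hp1 B hB.1, h₂ _ hp2 B hB.2]

/-- For every union-disjoint factorised representation `E` over a finite schema `S`,
the recursively defined count function computes the cardinality of the represented
relation: `count E = |⟦E⟧|`. -/
theorem count_correct {S : Finset Attr} (E : FRep S) (hE : E.UnionDisjoint) :
    E.count = E.rel.card := by
  induction E with
  | sing A a => simp [FRep.rel, FRep.count]
  | unit => simp [FRep.rel, FRep.count]
  | empty S => simp [FRep.rel, FRep.count]
  | union E₁ E₂ h₁ h₂ =>
    obtain ⟨hd, ha, hb⟩ := hE
    simp only [FRep.rel, FRep.count]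
    rw [Finset.card_union_of_disjoint hd, h₁ ha, h₂ hb]
  | @prod S₁ S₂ h E₁ E₂ h₁ h₂ =>
    obtain ⟨ha, hb⟩ := hE
    simp only [FRep.rel, FRep.count]
    rw [Finset.card_image_of_injOn, Finset.card_product, h₁ ha, h₂ hb]
    rintro ⟨x, y⟩ hp ⟨x', y'⟩ hq heq
    simp only [Finset.coe_product, Set.mem_prod, Finset.mem_coe] at hp hq
    have key : ∀ B, x B + y B = x' B + y' B := fun B => congrFun heq B
    have hxy : ∀ B, x B = x' B ∧ y B = y' B := by
      intro B
      have k := key B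
      by_cases hB : B ∈ S₁
      · have hB2 := Finset.disjoint_left.mp h hB
        have e1 := E₂.rel_over _ hp.2 B hB2
        have e2 := E₂.rel_over _ hq.2 B hB2
        constructor <;> linarith
      · have e1 := E₁.rel_over _ hp.1 B hB
        have e2 := E₁.rel_over _ hq.1 B hB
        constructor <;> linarith
    exact Prod.ext (funext fun B => (hxy B).1) (funext fun B => (hxy B).2)

end
end

section
/- Let E be a factorised representation over a finite schema S containing an attribute A, such that every subexpression of E represents a nonempty relation. The recursively defined function min_A — min_A(⟨A:a⟩) = a; min_A(E₁ ∪ ⋯ ∪ Eₙ) = minᵢ min_A(Eᵢ); and min_A(E₁ × ⋯ × Eₙ) = min_A(E_j), where E_j is the unique factor whose schema contains A — computes the minimum A-value of the represented relation: min_A(E) = min_{t ∈ ⟦E⟧} t(A). -/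
open scoped Classical

noncomputable section

namespace FRep

/-- Every subexpression of `E` represents a nonempty relation. -/
def AllNonempty : {S : Finset Attr} → FRep S → Prop
  | _, sing A a => (rel (sing A a)).Nonempty
  | _, unit => (rel unit).Nonempty
  | _, empty S => (rel (empty S)).Nonempty
  | _, union E₁ E₂ => (rel (union E₁ E₂)).Nonempty ∧ AllNonempty E₁ ∧ AllNonempty E₂
  | _, prod h E₁ E₂ => (rel (prod h E₁ E₂)).Nonempty ∧ AllNonempty E₁ ∧ AllNonempty E₂

/-- The recursively defined function `min_A`:
`min_A ⟨A:a⟩ = a`, `min_A (E₁ ∪ E₂) = min (min_A E₁) (min_A E₂)`, and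
`min_A (E₁ × E₂) = min_A E_j` where `E_j` is the unique factor whose schema
contains `A`. -/
def minA (A : Attr) : {S : Finset Attr} → FRep S → ℝ
  | _, sing _ a => a
  | _, unit => 0
  | _, empty _ => 0
  | _, union E₁ E₂ => min (minA A E₁) (minA A E₂)
  | _, @prod S₁ _ _ E₁ E₂ => if A ∈ S₁ then minA A E₁ else minA A E₂

end FRep

namespace FRep

theorem rel_zero {S : Finset Attr} (E : FRep S) :
    ∀ t ∈ E.rel, ∀ B, B ∉ S → t B = 0 := by
  induction E with
  | sing A a =>
    intro t ht B hB
    simp only [rel, Finset.mem_singleton] at ht hB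
    subst ht
    simp [hB]
  | unit =>
    intro t ht B hB
    simp only [rel, Finset.mem_singleton] at ht
    subst ht
    rfl
  | empty S => intro t ht; simp [rel] at ht
  | union E₁ E₂ ih₁ ih₂ =>
    intro t ht B hB
    simp only [rel, Finset.mem_union] at ht
    rcases ht with ht | ht
    · exact ih₁ t ht B hB
    · exact ih₂ t ht B hB
  | prod h E₁ E₂ ih₁ ih₂ =>
    intro t ht B hB
    simp only [rel, Finset.mem_image, Finset.mem_product] at ht
    obtain ⟨⟨u, v⟩, ⟨hu, hv⟩, rfl⟩ := ht
    simp only [Finset.mem_union, not_or] at hB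
    simp [ih₁ u hu B hB.1, ih₂ v hv B hB.2]

theorem AllNonempty.nonempty {S : Finset Attr} {E : FRep S} (h : E.AllNonempty) :
    E.rel.Nonempty := by
  cases E with
  | sing A a => exact h
  | unit => exact h
  | empty S => exact h
  | union E₁ E₂ => exact h.1
  | prod hd E₁ E₂ => exact h.1

theorem minA_spec {S : Finset Attr} (A : Attr) (E : FRep S) :
    A ∈ S → E.AllNonempty →
      (∃ t ∈ E.rel, t A = E.minA A) ∧ ∀ t ∈ E.rel, E.minA A ≤ t A := by
  induction E with
  | sing A' a =>
    intro hA _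
    simp only [Finset.mem_singleton] at hA
    subst hA
    simp [rel, minA]
  | unit => intro hA; simp at hA
  | empty S => intro _ h; simp [AllNonempty, rel] at h
  | union E₁ E₂ ih₁ ih₂ =>
    intro hA h
    obtain ⟨⟨t₁, ht₁, e₁⟩, l₁⟩ := ih₁ hA h.2.1
    obtain ⟨⟨t₂, ht₂, e₂⟩, l₂⟩ := ih₂ hA h.2.2
    simp only [rel, minA, Finset.mem_union]
    constructor
    · rcases min_choice (minA A E₁) (minA A E₂) with hm | hm
      · exact ⟨t₁, Or.inl ht₁, by rw [hm, e₁]⟩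
      · exact ⟨t₂, Or.inr ht₂, by rw [hm, e₂]⟩
    · rintro t (ht | ht)
      · exact (min_le_left _ _).trans (l₁ t ht)
      · exact (min_le_right _ _).trans (l₂ t ht)
  | @prod S₁ S₂ hd E₁ E₂ ih₁ ih₂ =>
    intro hA h
    simp only [rel, minA, Finset.mem_image, Finset.mem_product]
    by_cases h1 : A ∈ S₁
    · have h2 : A ∉ S₂ := Finset.disjoint_left.mp hd h1
      obtain ⟨⟨t₁, ht₁, e₁⟩, l₁⟩ := ih₁ h1 h.2.1
      obtain ⟨t₂, ht₂⟩ := h.2.2.nonempty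
      rw [if_pos h1]
      constructor
      · exact ⟨t₁ + t₂, ⟨(t₁, t₂), ⟨ht₁, ht₂⟩, rfl⟩, by
          simp [e₁, rel_zero E₂ t₂ ht₂ A h2]⟩
      · rintro t ⟨⟨u, v⟩, ⟨hu, hv⟩, rfl⟩
        simpa [rel_zero E₂ v hv A h2] using l₁ u hu
    · have h2 : A ∈ S₂ := (Finset.mem_union.mp hA).resolve_left h1
      obtain ⟨⟨t₂, ht₂, e₂⟩, l₂⟩ := ih₂ h2 h.2.2
      obtain ⟨t₁, ht₁⟩ := h.2.1.nonempty
      rw [if_neg h1]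
      constructor
      · exact ⟨t₁ + t₂, ⟨(t₁, t₂), ⟨ht₁, ht₂⟩, rfl⟩, by
          simp [e₂, rel_zero E₁ t₁ ht₁ A h1]⟩
      · rintro t ⟨⟨u, v⟩, ⟨hu, hv⟩, rfl⟩
        simpa [rel_zero E₁ u hu A h1] using l₂ v hv

end FRep

/-- Let `E` be a factorised representation over a finite schema `S` containing the
attribute `A`, such that every subexpression of `E` represents a nonempty relation.
Then the recursively defined function `min_A` computes the minimum `A`-value of the
represented relation: `min_A E = min_{t ∈ ⟦E⟧} t(A)` (the minimum of a nonempty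
finite set of reals, expressed as its infimum). -/
theorem minA_correct {S : Finset Attr} (A : Attr) (E : FRep S)
    (hA : A ∈ S) (hE : E.AllNonempty) :
    E.minA A = sInf ((fun t => t A) '' (E.rel : Set Tuple)) := by
  obtain ⟨⟨t, ht, e⟩, l⟩ := FRep.minA_spec A E hA hE
  have hl : IsLeast ((fun t : Tuple => t A) '' (E.rel : Set Tuple)) (E.minA A) := by
    refine ⟨⟨t, ht, e⟩, ?_⟩
    rintro _ ⟨u, hu, rfl⟩
    exact l u hu
  exact hl.csInf_eq.symm

end
end

section
/- Let E be a factorised representation over a finite schema S containing an attribute A, such that every subexpression of E represents a nonempty relation. The recursively defined function max_A — max_A(⟨A:a⟩) = a; max_A(E₁ ∪ ⋯ ∪ Eₙ) = maxᵢ max_A(Eᵢ); and max_A(E₁ × ⋯ × Eₙ) = max_A(E_j), where E_j is the unique factor whose schema contains A — computes the maximum A-value of the represented relation: max_A(E) = max_{t ∈ ⟦E⟧} t(A). -/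
open scoped Classical

noncomputable section

namespace FRep

/-- The recursively defined function `max_A`:
`max_A ⟨A:a⟩ = a`, `max_A (E₁ ∪ E₂) = min (max_A E₁) (max_A E₂)`, and
`max_A (E₁ × E₂) = max_A E_j` where `E_j` is the unique factor whose schema
contains `A`. -/
def maxA (A : Attr) : {S : Finset Attr} → FRep S → ℝ
  | _, sing _ a => a
  | _, unit => 0
  | _, empty _ => 0
  | _, union E₁ E₂ => max (maxA A E₁) (maxA A E₂)
  | _, @prod S₁ _ _ E₁ E₂ => if A ∈ S₁ then maxA A E₁ else maxA A E₂

end FRep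

theorem FRep.rel_zero_s3 (A : Attr) {S : Finset Attr} (E : FRep S) (hA : A ∉ S) :
    ∀ t ∈ E.rel, t A = 0 := by
  induction E with
  | sing B a =>
    intro t ht
    simp only [FRep.rel, Finset.mem_singleton] at ht hA
    subst ht
    simp [hA]
  | unit =>
    intro t ht
    simp only [FRep.rel, Finset.mem_singleton] at ht
    subst ht
    rfl
  | empty S => intro t ht; simp [FRep.rel] at ht
  | union E₁ E₂ ih₁ ih₂ =>
    intro t ht
    simp only [FRep.rel, Finset.mem_union] at ht
    exact ht.elim (ih₁ hA t) (ih₂ hA t)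
  | prod h E₁ E₂ ih₁ ih₂ =>
    intro t ht
    simp only [FRep.rel, Finset.mem_image, Finset.mem_product] at ht
    obtain ⟨p, ⟨h1, h2⟩, rfl⟩ := ht
    simp only [Finset.mem_union, not_or] at hA
    simp [ih₁ hA.1 _ h1, ih₂ hA.2 _ h2]

theorem FRep.AllNonempty.rel_nonempty {S : Finset Attr} {E : FRep S} (h : E.AllNonempty) :
    E.rel.Nonempty := by
  cases E with
  | sing B a => exact h
  | unit => exact h
  | empty S => exact h
  | union E₁ E₂ => exact h.1
  | prod h' E₁ E₂ => exact h.1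

theorem FRep.maxA_spec {S : Finset Attr} (A : Attr) (E : FRep S)
    (hA : A ∈ S) (hE : E.AllNonempty) :
    (∃ t ∈ E.rel, t A = E.maxA A) ∧ ∀ t ∈ E.rel, t A ≤ E.maxA A := by
  induction E with
  | sing B a =>
    simp only [Finset.mem_singleton] at hA
    simp [FRep.rel, FRep.maxA, hA]
  | unit => simp at hA
  | empty S => simp [FRep.AllNonempty, FRep.rel] at hE
  | union E₁ E₂ ih₁ ih₂ =>
    obtain ⟨⟨t₁, m₁, e₁⟩, b₁⟩ := ih₁ hA hE.2.1
    obtain ⟨⟨t₂, m₂, e₂⟩, b₂⟩ := ih₂ hA hE.2.2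
    simp only [FRep.rel, FRep.maxA, Finset.mem_union]
    constructor
    · rcases le_total (E₁.maxA A) (E₂.maxA A) with h | h
      · exact ⟨t₂, Or.inr m₂, by rw [max_eq_right h, e₂]⟩
      · exact ⟨t₁, Or.inl m₁, by rw [max_eq_left h, e₁]⟩
    · rintro t (ht | ht)
      · exact le_max_of_le_left (b₁ t ht)
      · exact le_max_of_le_right (b₂ t ht)
  | @prod S₁ S₂ h E₁ E₂ ih₁ ih₂ =>
    simp only [FRep.rel, FRep.maxA, Finset.mem_image, Finset.mem_product]
    by_cases h1 : A ∈ S₁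
    · have z := FRep.rel_zero_s3 A E₂ (Finset.disjoint_left.mp h h1)
      obtain ⟨⟨t₁, m₁, e₁⟩, b₁⟩ := ih₁ h1 hE.2.1
      obtain ⟨t₂, m₂⟩ := hE.2.2.rel_nonempty
      rw [if_pos h1]
      refine ⟨⟨t₁ + t₂, ⟨(t₁, t₂), ⟨m₁, m₂⟩, rfl⟩, by simp [z t₂ m₂, e₁]⟩, ?_⟩
      rintro _ ⟨p, ⟨hp1, hp2⟩, rfl⟩
      simpa [z _ hp2] using b₁ _ hp1
    · have z := FRep.rel_zero_s3 A E₁ h1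
      have h2 : A ∈ S₂ := (Finset.mem_union.mp hA).resolve_left h1
      obtain ⟨⟨t₂, m₂, e₂⟩, b₂⟩ := ih₂ h2 hE.2.2
      obtain ⟨t₁, m₁⟩ := hE.2.1.rel_nonempty
      rw [if_neg h1]
      refine ⟨⟨t₁ + t₂, ⟨(t₁, t₂), ⟨m₁, m₂⟩, rfl⟩, by simp [z t₁ m₁, e₂]⟩, ?_⟩
      rintro _ ⟨p, ⟨hp1, hp2⟩, rfl⟩
      simpa [z _ hp1] using b₂ _ hp2

/-- Let `E` be a factorised representation over a finite schema `S` containing the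
attribute `A`, such that every subexpression of `E` represents a nonempty relation.
Then the recursively defined function `max_A` computes the maximum `A`-value of the
represented relation: `max_A E = min_{t ∈ ⟦E⟧} t(A)` (the maximum of a nonempty
finite set of reals, expressed as its supremum). -/
theorem maxA_correct {S : Finset Attr} (A : Attr) (E : FRep S)
    (hA : A ∈ S) (hE : E.AllNonempty) :
    E.maxA A = sSup ((fun t => t A) '' (E.rel : Set Tuple)) := by
  obtain ⟨⟨t, m, e⟩, b⟩ := FRep.maxA_spec A E hA hE
  have hg : IsGreatest ((fun t => t A) '' (E.rel : Set Tuple)) (E.maxA A) := by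
    refine ⟨⟨t, m, e⟩, ?_⟩
    rintro _ ⟨s, hs, rfl⟩
    exact b s hs
  exact hg.csSup_eq.symm

end
end

section
/- (The swap operator preserves the represented relation.) Let A and B be distinct attributes and let S_A, S_B, S_{AB} be finite attribute sets such that {A}, {B}, S_A, S_B, S_{AB} are pairwise disjoint. Let I and J be finite sets of reals; for each a ∈ I let E_a be a finite relation over S_A, for each b ∈ J let F_b be a finite relation over S_B, and for each (a,b) ∈ I × J let G_{ab} be a finite relation over S_{AB}. Then, as relations over {A} ∪ {B} ∪ S_A ∪ S_B ∪ S_{AB}: ⋃_{a∈I} ( {⟨A:a⟩} × E_a × ⋃_{b∈J} ( {⟨B:b⟩} × F_b × G_{ab} ) ) = ⋃_{b∈J} ( {⟨B:b⟩} × F_b × ⋃_{a∈I} ( {⟨A:a⟩} × E_a × G_{ab} ) ), where {⟨A:a⟩} is the one-tuple relation over {A} with A-value a, and × is the relational product of relations over disjoint schemas. -/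
open scoped Classical

noncomputable section

/-- The one-tuple relation tuple `⟨A:a⟩`. -/
def singTup (A : Attr) (a : ℝ) : Tuple := fun B => if B = A then a else 0

/-- The one-tuple relation `{⟨A:a⟩}` over schema `{A}`. -/
def singRel (A : Attr) (a : ℝ) : Finset Tuple := {singTup A a}

/-- Relational product of two relations over disjoint schemas: the common
extension of two tuples with disjoint supports is their pointwise sum. -/
def rprod (R₁ R₂ : Finset Tuple) : Finset Tuple :=
  (R₁ ×ˢ R₂).image fun p => p.1 + p.2

theorem mem_rprod_iff (R₁ R₂ : Finset Tuple) (t : Tuple) :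
    t ∈ rprod R₁ R₂ ↔ ∃ x ∈ R₁, ∃ y ∈ R₂, x + y = t := by
  simp only [rprod, Finset.mem_image, Finset.mem_product, Prod.exists]
  constructor
  · rintro ⟨x, y, ⟨hx, hy⟩, h⟩
    exact ⟨x, hx, y, hy, h⟩
  · rintro ⟨x, hx, y, hy, h⟩
    exact ⟨x, y, ⟨hx, hy⟩, h⟩

/-- The swap operator preserves the represented relation:
`⋃_{a∈I} (⟨A:a⟩ × E_a × ⋃_{b∈J} (⟨B:b⟩ × F_b × G_{ab}))
 = ⋃_{b∈J} (⟨B:b⟩ × F_b × ⋃_{a∈I} (⟨A:a⟩ × E_a × G_{ab}))`,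
where `A`, `B` are distinct attributes, the schemas `{A}`, `{B}`, `S_A`, `S_B`,
`S_{AB}` are pairwise disjoint, `E_a` is a relation over `S_A`, `F_b` over `S_B`,
and `G_{ab}` over `S_{AB}`. -/
theorem swap_preserves_relation (A B : Attr) (SA SB SAB : Finset Attr)
    (hAB : A ≠ B)
    (hASA : A ∉ SA) (hASB : A ∉ SB) (hASAB : A ∉ SAB)
    (hBSA : B ∉ SA) (hBSB : B ∉ SB) (hBSAB : B ∉ SAB)
    (hSASB : Disjoint SA SB) (hSASAB : Disjoint SA SAB) (hSBSAB : Disjoint SB SAB)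
    (I J : Finset ℝ)
    (E : ℝ → Finset Tuple) (F : ℝ → Finset Tuple) (G : ℝ → ℝ → Finset Tuple)
    (hE : ∀ a ∈ I, ∀ t ∈ E a, IsOverSchema t SA)
    (hF : ∀ b ∈ J, ∀ t ∈ F b, IsOverSchema t SB)
    (hG : ∀ a ∈ I, ∀ b ∈ J, ∀ t ∈ G a b, IsOverSchema t SAB) :
    I.biUnion (fun a => rprod (singRel A a) (rprod (E a)
        (J.biUnion fun b => rprod (singRel B b) (rprod (F b) (G a b)))))
      = J.biUnion (fun b => rprod (singRel B b) (rprod (F b)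
        (I.biUnion fun a => rprod (singRel A a) (rprod (E a) (G a b))))) := by
  ext t
  simp only [Finset.mem_biUnion, mem_rprod_iff, singRel, Finset.mem_singleton]
  constructor
  · rintro ⟨a, ha, x, hx, y, ⟨e, he, z, ⟨b, hb, u, hu, v, ⟨f, hf, g, hg, rfl⟩, rfl⟩, rfl⟩, rfl⟩
    exact ⟨b, hb, u, hu, _, ⟨f, hf, _, ⟨a, ha, x, hx, _, ⟨e, he, g, hg, rfl⟩, rfl⟩, rfl⟩, by abel⟩
  · rintro ⟨b, hb, x, hx, y, ⟨e, he, z, ⟨a, ha, u, hu, v, ⟨f, hf, g, hg, rfl⟩, rfl⟩, rfl⟩, rfl⟩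
    exact ⟨a, ha, u, hu, _, ⟨f, hf, _, ⟨b, hb, x, hx, _, ⟨e, he, g, hg, rfl⟩, rfl⟩, rfl⟩, by abel⟩

end
end
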